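/- arXiv:2112.09327 — 7 statements merged into one kernel-verified Lean document; each statement's English description precedes it below -/
import Mathlib

section
/- Let S ⊆ T with 2 ≤ s := |S| and 2 ≤ t := |T|. Then the data valuation function can be re-expressed as v(S) = (s−1)⁻¹·(σ_S − k*) − MMD²_u(S,T) + σ'_T; in particular, the additive term c := σ'_T is independent of S. -/
open Finset

/-- Within-set (biased) kernel average: σ_S := s⁻² Σ_{x∈S} Σ_{x'∈S} k(x,x'). -/
noncomputable def sigmaSet {α : Type*} [DecidableEq α] (k : α → α → ℝ) (S : Finset α) : ℝ :=
  ((S.card : ℝ) ^ 2)⁻¹ * ∑ x ∈ S, ∑ x' ∈ S, k x x'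

/-- Cross kernel average: σ_{ST} := 2(st)⁻¹ Σ_{x∈S} Σ_{x'∈T} k(x,x'). -/
noncomputable def sigmaCross {α : Type*} [DecidableEq α] (k : α → α → ℝ) (S T : Finset α) : ℝ :=
  2 * ((S.card : ℝ) * (T.card : ℝ))⁻¹ * ∑ x ∈ S, ∑ x' ∈ T, k x x'

/-- Unbiased within-set kernel average: σ'_S := (s(s−1))⁻¹ Σ_{x∈S} Σ_{x'∈S, x'≠x} k(x,x'). -/
noncomputable def sigmaSet' {α : Type*} [DecidableEq α] (k : α → α → ℝ) (S : Finset α) : ℝ :=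
  ((S.card : ℝ) * ((S.card : ℝ) - 1))⁻¹ * ∑ x ∈ S, ∑ x' ∈ S.erase x, k x x'

/-- Unbiased squared-MMD estimate: MMD²_u(S,T) := σ'_S − σ_{ST} + σ'_T. -/
noncomputable def mmdU {α : Type*} [DecidableEq α] (k : α → α → ℝ) (S T : Finset α) : ℝ :=
  sigmaSet' k S - sigmaCross k S T + sigmaSet' k T

/-- Data valuation function: v(S) := σ_{ST} − σ_S. -/
noncomputable def dataVal {α : Type*} [DecidableEq α] (k : α → α → ℝ) (S T : Finset α) : ℝ :=
  sigmaCross k S T - sigmaSet k S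

/-- For a kernel with constant diagonal `c` on `S`, the off-diagonal sum is the full sum
minus `|S| * c`. -/
theorem sum_sum_erase_eq_of_diag {α : Type*} [DecidableEq α] (k : α → α → ℝ) (c : ℝ)
    (S : Finset α) (hdiag : ∀ x ∈ S, k x x = c) :
    ∑ x ∈ S, ∑ x' ∈ S.erase x, k x x' = (∑ x ∈ S, ∑ x' ∈ S, k x x') - (S.card : ℝ) * c := by
  rw [← nsmul_eq_mul, ← Finset.sum_const, ← Finset.sum_sub_distrib]
  refine Finset.sum_congr rfl fun x hx => ?_
  rw [Finset.sum_erase_eq_sub hx, hdiag x hx]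

/-- The data valuation function can be re-expressed as
`v(S) = (s−1)⁻¹ (σ_S − k*) − MMD²_u(S,T) + σ'_T`, where the additive term
`c := σ'_T` is independent of `S`. -/
theorem dataVal_eq {α : Type*} [DecidableEq α] (k : α → α → ℝ) (kstar : ℝ)
    (S T : Finset α) (hST : S ⊆ T)
    (hsymm : ∀ x ∈ T, ∀ x' ∈ T, k x x' = k x' x)
    (hdiag : ∀ x ∈ T, k x x = kstar)
    (hs : 2 ≤ S.card) (ht : 2 ≤ T.card) :
    dataVal k S T =
      ((S.card : ℝ) - 1)⁻¹ * (sigmaSet k S - kstar) - mmdU k S T + sigmaSet' k T := by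
  have hs' : (2 : ℝ) ≤ S.card := by exact_mod_cast hs
  have h0 : (S.card : ℝ) ≠ 0 := by linarith
  have h1 : (S.card : ℝ) - 1 ≠ 0 := by linarith
  have key : sigmaSet' k S - sigmaSet k S = ((S.card : ℝ) - 1)⁻¹ * (sigmaSet k S - kstar) := by
    rw [sigmaSet', sigmaSet, sum_sum_erase_eq_of_diag k kstar S fun x hx => hdiag x (hST hx)]
    field_simp
    ring
  rw [dataVal, mmdU, ← key]
  ring
end

section
/- Let S ⊆ T with 2 ≤ s := |S| and 2 ≤ t := |T|, and suppose there exist constants γ and η such that γ ≤ k(x,x') ≤ η ≤ k* for all x, x' ∈ T with x ≠ x'. Then s⁻¹·(γ − k*) − MMD²_u(S,T) + σ'_T ≤ v(S) ≤ s⁻¹·(η − k*) − MMD²_u(S,T) + σ'_T. -/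
open Finset

/-- The biased average is a convex combination of the diagonal value and the unbiased average. -/
lemma sigmaSet_eq_of_diag {α : Type*} [DecidableEq α] (k : α → α → ℝ) (c : ℝ) (S : Finset α)
    (hdiag : ∀ x ∈ S, k x x = c) (hs : 2 ≤ S.card) :
    sigmaSet k S = sigmaSet' k S + (S.card : ℝ)⁻¹ * (c - sigmaSet' k S) := by
  have hs' : (2 : ℝ) ≤ S.card := by exact_mod_cast hs
  have h0 : (S.card : ℝ) ≠ 0 := by linarith
  have h1 : (S.card : ℝ) - 1 ≠ 0 := by linarith
  have hsum : ∑ x ∈ S, ∑ x' ∈ S, k x x' =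
      S.card * c + ∑ x ∈ S, ∑ x' ∈ S.erase x, k x x' := by
    rw [← nsmul_eq_mul, ← Finset.sum_const, ← Finset.sum_add_distrib]
    refine Finset.sum_congr rfl fun x hx => ?_
    rw [← hdiag x hx, Finset.add_sum_erase S (k x) hx]
  rw [sigmaSet, sigmaSet', hsum]
  field_simp
  ring

lemma sum_sum_erase_const {α : Type*} [DecidableEq α] (S : Finset α) (c : ℝ) :
    ∑ x ∈ S, ∑ _x' ∈ S.erase x, c = (S.card : ℝ) * ((S.card : ℝ) - 1) * c := by
  have h : ∀ x ∈ S, ∑ _x' ∈ S.erase x, c = ((S.card : ℝ) - 1) * c := fun x hx => by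
    rw [Finset.sum_const, nsmul_eq_mul, Finset.cast_card_erase_of_mem hx]
  rw [Finset.sum_congr rfl h, Finset.sum_const, nsmul_eq_mul, mul_assoc]

lemma sigmaSet'_mem_Icc {α : Type*} [DecidableEq α] (k : α → α → ℝ) (γ η : ℝ) (S : Finset α)
    (hbound : ∀ x ∈ S, ∀ x' ∈ S, x ≠ x' → γ ≤ k x x' ∧ k x x' ≤ η) (hs : 2 ≤ S.card) :
    sigmaSet' k S ∈ Set.Icc γ η := by
  have hs' : (2 : ℝ) ≤ S.card := by exact_mod_cast hs
  have hpos : 0 < (S.card : ℝ) * ((S.card : ℝ) - 1) := mul_pos (by linarith) (by linarith)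
  have hk : ∀ x ∈ S, ∀ x' ∈ S.erase x, γ ≤ k x x' ∧ k x x' ≤ η := fun x hx x' hx' =>
    hbound x hx x' (Finset.mem_of_mem_erase hx') (Finset.ne_of_mem_erase hx').symm
  rw [sigmaSet', Set.mem_Icc, le_inv_mul_iff₀ hpos, inv_mul_le_iff₀ hpos,
    ← sum_sum_erase_const, ← sum_sum_erase_const]
  exact ⟨Finset.sum_le_sum fun x hx => Finset.sum_le_sum fun x' hx' => (hk x hx x' hx').1,
    Finset.sum_le_sum fun x hx => Finset.sum_le_sum fun x' hx' => (hk x hx x' hx').2⟩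

/-- If `γ ≤ k(x,x') ≤ η ≤ k*` for all distinct `x, x' ∈ T`, then
`s⁻¹(γ − k*) − MMD²_u(S,T) + σ'_T ≤ v(S) ≤ s⁻¹(η − k*) − MMD²_u(S,T) + σ'_T`. -/
theorem dataVal_bounds {α : Type*} [DecidableEq α] (k : α → α → ℝ) (kstar γ η : ℝ)
    (S T : Finset α) (hST : S ⊆ T)
    (hsymm : ∀ x ∈ T, ∀ x' ∈ T, k x x' = k x' x)
    (hdiag : ∀ x ∈ T, k x x = kstar)
    (hbound : ∀ x ∈ T, ∀ x' ∈ T, x ≠ x' → γ ≤ k x x' ∧ k x x' ≤ η)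
    (hη : η ≤ kstar)
    (hs : 2 ≤ S.card) (ht : 2 ≤ T.card) :
    (S.card : ℝ)⁻¹ * (γ - kstar) - mmdU k S T + sigmaSet' k T ≤ dataVal k S T ∧
      dataVal k S T ≤ (S.card : ℝ)⁻¹ * (η - kstar) - mmdU k S T + sigmaSet' k T := by
  obtain ⟨hγ, hη'⟩ := sigmaSet'_mem_Icc k γ η S
    (fun x hx x' hx' => hbound x (hST hx) x' (hST hx')) hs
  have hσ := sigmaSet_eq_of_diag k kstar S (fun x hx => hdiag x (hST hx)) hs
  have hinv : (0 : ℝ) ≤ (S.card : ℝ)⁻¹ := by positivity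
  have h₁ := mul_le_mul_of_nonneg_left hγ hinv
  have h₂ := mul_le_mul_of_nonneg_left hη' hinv
  rw [dataVal, mmdU, hσ]
  constructor <;> linarith
end

section
/- Let S ⊆ T be nonempty with s := |S| and 2s ≤ t := |T|, and let η be a constant with η ≤ k*. If every off-diagonal kernel value satisfies (t−2s)·(k* + (s−1)η)/(2s(t−s)) ≤ k(x,x') ≤ η for all x, x' ∈ T with x ≠ x', then the data valuation is non-negative: v(S) ≥ 0. -/
open Finset

/-- Lower bound of the kernel for non-negative data valuation: if `2s ≤ t`, `η ≤ k*`,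
and every off-diagonal kernel value satisfies
`(t−2s)(k* + (s−1)η)/(2s(t−s)) ≤ k(x,x') ≤ η`, then `v(S) ≥ 0`. -/
theorem dataVal_nonneg {α : Type*} [DecidableEq α] (k : α → α → ℝ) (kstar η : ℝ)
    (S T : Finset α) (hST : S ⊆ T) (hne : S.Nonempty)
    (hsymm : ∀ x ∈ T, ∀ x' ∈ T, k x x' = k x' x)
    (hdiag : ∀ x ∈ T, k x x = kstar)
    (hst : 2 * S.card ≤ T.card)
    (hη : η ≤ kstar)
    (hbound : ∀ x ∈ T, ∀ x' ∈ T, x ≠ x' →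
      ((T.card : ℝ) - 2 * (S.card : ℝ)) * (kstar + ((S.card : ℝ) - 1) * η) /
          (2 * (S.card : ℝ) * ((T.card : ℝ) - (S.card : ℝ))) ≤ k x x' ∧ k x x' ≤ η) :
    0 ≤ dataVal k S T := by
  have hs : (0 : ℝ) < S.card := by exact_mod_cast hne.card_pos
  have hst' : 2 * (S.card : ℝ) ≤ T.card := by exact_mod_cast hst
  have ht : (0 : ℝ) < T.card := by linarith
  have hts : (0 : ℝ) < (T.card : ℝ) - S.card := by linarith
  have hA : ∑ x ∈ S, ∑ x' ∈ S, k x x' ≤ S.card * (kstar + ((S.card : ℝ) - 1) * η) := by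
    rw [← nsmul_eq_mul]
    refine Finset.sum_le_card_nsmul _ _ _ fun x hx => ?_
    rw [← Finset.add_sum_erase S _ hx, hdiag x (hST hx)]
    have h := Finset.sum_le_card_nsmul (S.erase x) (fun x' => k x x') η fun x' hx' =>
      (hbound x (hST hx) x' (hST (Finset.mem_of_mem_erase hx'))
        (Finset.ne_of_mem_erase hx').symm).2
    rw [nsmul_eq_mul, Finset.cast_card_erase_of_mem hx] at h
    linarith
  have hB : (S.card : ℝ) * (((T.card : ℝ) - S.card) *
      (((T.card : ℝ) - 2 * (S.card : ℝ)) * (kstar + ((S.card : ℝ) - 1) * η) /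
        (2 * (S.card : ℝ) * ((T.card : ℝ) - (S.card : ℝ))))) ≤
      ∑ x ∈ S, ∑ x' ∈ T \ S, k x x' := by
    rw [← nsmul_eq_mul]
    refine Finset.card_nsmul_le_sum _ _ _ fun x hx => ?_
    rw [← Finset.cast_card_sdiff hST, ← nsmul_eq_mul, Finset.cast_card_sdiff hST]
    refine Finset.card_nsmul_le_sum _ _ _ fun x' hx' => ?_
    rw [Finset.mem_sdiff] at hx'
    exact (hbound x (hST hx) x' hx'.1 (ne_of_mem_of_not_mem hx hx'.2)).1
  have hsplit : ∑ x ∈ S, ∑ x' ∈ T, k x x' =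
      ∑ x ∈ S, ∑ x' ∈ T \ S, k x x' + ∑ x ∈ S, ∑ x' ∈ S, k x x' := by
    rw [← Finset.sum_add_distrib]
    exact Finset.sum_congr rfl fun x _ => (Finset.sum_sdiff hST).symm
  unfold dataVal sigmaCross sigmaSet
  rw [hsplit]
  generalize ∑ x ∈ S, ∑ x' ∈ S, k x x' = A at *
  generalize ∑ x ∈ S, ∑ x' ∈ T \ S, k x x' = B at *
  have hB' : ((T.card : ℝ) - 2 * S.card) * (kstar + ((S.card : ℝ) - 1) * η) ≤ 2 * B := by
    field_simp at hB
    linarith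
  have hA' := mul_le_mul_of_nonneg_left hA (sub_nonneg.2 hst')
  have hB'' := mul_le_mul_of_nonneg_left hB' hs.le
  have key : 2 * ((S.card : ℝ) * T.card)⁻¹ * (B + A) - ((S.card : ℝ) ^ 2)⁻¹ * A =
      (2 * S.card * B - ((T.card : ℝ) - 2 * S.card) * A) / ((S.card : ℝ) ^ 2 * T.card) := by
    field_simp
    ring
  rw [key]
  refine div_nonneg ?_ (by positivity)
  linarith
end

section
/- Let k*, s, t be real numbers with k* > 0, s > 0, and s < t/2 − 1. Define η := t·k*/((s+1)·(s(t−2)+t)) and γ := (t−2s)·(k* + (s−1)η)/(2s(t−s)). Then γ > η. -/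
/-- If `k* > 0`, `s > 0`, and `s < t/2 − 1`, then with
`η := t k*/((s+1)(s(t−2)+t))` and `γ := (t−2s)(k* + (s−1)η)/(2s(t−s))`, one has `γ > η`. -/
theorem gamma_gt_eta (kstar s t : ℝ) (hk : 0 < kstar) (hs : 0 < s) (hst : s < t / 2 - 1) :
    (t - 2 * s) * (kstar + (s - 1) * (t * kstar / ((s + 1) * (s * (t - 2) + t)))) /
        (2 * s * (t - s)) >
      t * kstar / ((s + 1) * (s * (t - 2) + t)) := by
  have ht : 0 < t - 2 * s - 2 := by linarith
  have hts : 0 < t - s := by linarith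
  have hq : 0 < s * (t - 2) + t := by
    have := mul_pos hs (show 0 < t - 2 by linarith)
    linarith
  have hfactor : 0 < (s + 1) * t - 2 * s := by linarith
  have hdiff : (t - 2 * s) * (kstar + (s - 1) * (t * kstar / ((s + 1) * (s * (t - 2) + t)))) /
        (2 * s * (t - s)) - t * kstar / ((s + 1) * (s * (t - 2) + t)) =
      kstar * (t - 2 * s - 2) * ((s + 1) * t - 2 * s) /
        (2 * (t - s) * ((s + 1) * (s * (t - 2) + t))) := by
    have hs1 : s + 1 ≠ 0 := by positivity
    field_simp
    ring
  rw [gt_iff_lt, ← sub_pos, hdiff]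
  positivity
end

section
/- Let t ≥ 2 and k* > 0 be real numbers. For a ∈ (0,1), define η(a) := k*/((a·t+1)·(a·t−2a+1)) and γ(a) := ((1−2a)/(2·a·t·(1−a)))·(k* + (a·t−1)·η(a)). Then the function a ↦ η(a) − γ(a) is strictly increasing on the open interval (0,1). -/
/-- Closed form of `η(a) − γ(a)`: the factor `at − 2a + 1` cancels. -/
theorem eta_sub_gamma_eq {t a : ℝ} (kstar : ℝ) (ht : 2 ≤ t) (ha : a ∈ Set.Ioo (0 : ℝ) 1) :
    kstar / ((a * t + 1) * (a * t - 2 * a + 1)) -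
        (1 - 2 * a) / (2 * a * t * (1 - a)) *
          (kstar + (a * t - 1) * (kstar / ((a * t + 1) * (a * t - 2 * a + 1)))) =
      kstar / (2 * t) * ((2 * a * t + 2 - t) / ((1 - a) * (a * t + 1))) := by
  obtain ⟨h0, h1⟩ := ha
  have hA : a * t + 1 ≠ 0 := by positivity
  have hB : a * (t - 2) + 1 ≠ 0 := by nlinarith
  have hC : 1 - a ≠ 0 := by linarith
  have ha0 : a ≠ 0 := h0.ne'
  have ht0 : t ≠ 0 := by linarith
  field_simp
  ring

/-- For `t ≥ 2` and `k* > 0`, the difference `η(a) − γ(a)` between the monotonicity upper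
bound `η(a) := k*/((at+1)(at−2a+1))` and the non-negativity lower bound
`γ(a) := ((1−2a)/(2at(1−a))) (k* + (at−1) η(a))` is strictly increasing on `(0,1)`. -/
theorem eta_sub_gamma_strictMonoOn (t kstar : ℝ) (ht : 2 ≤ t) (hk : 0 < kstar) :
    StrictMonoOn
      (fun a : ℝ =>
        kstar / ((a * t + 1) * (a * t - 2 * a + 1)) -
          (1 - 2 * a) / (2 * a * t * (1 - a)) *
            (kstar + (a * t - 1) * (kstar / ((a * t + 1) * (a * t - 2 * a + 1)))))
      (Set.Ioo (0 : ℝ) 1) := by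
  intro a ha b hb hab
  simp only [eta_sub_gamma_eq kstar ht ha, eta_sub_gamma_eq kstar ht hb]
  obtain ⟨ha0, ha1⟩ := ha
  obtain ⟨hb0, hb1⟩ := hb
  have ha' : 0 < 1 - a := by linarith
  have hb' : 0 < 1 - b := by linarith
  have hQ : 0 < (1 - a) * (1 - b) * (t ^ 2 - t + 2) +
      (a * (1 - b) + b * (1 - a)) * (t + 2) + a * b * (t ^ 2 + 3 * t + 2) := by
    have h : 0 < t ^ 2 - t + 2 := by nlinarith
    positivity
  have hlt : (2 * a * t + 2 - t) / ((1 - a) * (a * t + 1)) <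
      (2 * b * t + 2 - t) / ((1 - b) * (b * t + 1)) := by
    rw [div_lt_div_iff₀ (by positivity) (by positivity)]
    linear_combination mul_pos (sub_pos.mpr hab) hQ
  exact mul_lt_mul_of_pos_left hlt (by positivity)
end

section
/- Let v_c be non-negative and monotone, φ* > 0, ρ ∈ (0,1], v* > 0, and suppose v_c({i}) ≤ (φ_i/φ*)^ρ · v* for every i ∈ N. Then r_i = (φ_i/φ*)^ρ · v* for every i ∈ N, and for any distinct parties i, j ∈ N such that there exists C ⊆ N \ {i,j} with v_c(C ∪ {i}) > v_c(C ∪ {j}) and v_c(B ∪ {i}) ≥ v_c(B ∪ {j}) for every B ⊆ N \ {i,j}, one has r_i > r_j. -/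
open Finset

/-- The Shapley value of party `i`:
`φ_i := (1/n!) Σ_{π} [v(C_{π,i} ∪ {i}) − v(C_{π,i})]`, where `π` ranges over all `n!`
orderings (bijections `Fin n ≃ N`) of the party set `N` and `C_{π,i}` is the set of
parties preceding `i` in the ordering `π`. -/
noncomputable def shapley {N : Type*} [Fintype N] [DecidableEq N]
    (v : Finset N → ℝ) (i : N) : ℝ :=
  ((Nat.factorial (Fintype.card N) : ℝ))⁻¹ *
    ∑ π : Fin (Fintype.card N) ≃ N,
      (v (insert i (Finset.univ.filter fun j => π.symm j < π.symm i)) -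
        v (Finset.univ.filter fun j => π.symm j < π.symm i))

/-- The maximum Shapley value `φ* := max_{j ∈ N} φ_j`. -/
noncomputable def phiStar {N : Type*} [Fintype N] [DecidableEq N] [Nonempty N]
    (v : Finset N → ℝ) : ℝ :=
  Finset.univ.sup' Finset.univ_nonempty (shapley v)

/-- The rectified ρ-Shapley fair reward value of party `i`:
`r_i := max {v({i}), (φ_i/φ*)^ρ · v*}` (the power is the real power `rpow`). -/
noncomputable def reward {N : Type*} [Fintype N] [DecidableEq N] [Nonempty N]
    (v : Finset N → ℝ) (ρ vstar : ℝ) (i : N) : ℝ :=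
  max (v {i}) ((shapley v i / phiStar v) ^ ρ * vstar)

/-- A characteristic function is non-negative if `v(C) ≥ 0` for every coalition. -/
def NonnegCF {N : Type*} [Fintype N] [DecidableEq N] (v : Finset N → ℝ) : Prop :=
  ∀ C : Finset N, 0 ≤ v C

/-- A characteristic function is monotone if `v(C) ≤ v(C')` whenever `C ⊆ C'`. -/
def MonotoneCF {N : Type*} [Fintype N] [DecidableEq N] (v : Finset N → ℝ) : Prop :=
  ∀ C C' : Finset N, C ⊆ C' → v C ≤ v C'

/-- Every coalition avoiding `i` is the set of predecessors of `i` in some ordering. -/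
lemma exists_ordering_filter_lt_eq {N : Type*} [Fintype N] [DecidableEq N]
    (i : N) (C : Finset N) (hi : i ∉ C) :
    ∃ π : Fin (Fintype.card N) ≃ N,
      (Finset.univ.filter fun k => π.symm k < π.symm i) = C := by
  let f : N → ℕ := fun k => if k ∈ C then 0 else if k = i then 1 else 2
  let e := (Fintype.equivFin N).symm
  let π := (Tuple.sort (f ∘ e)).trans e
  have hmono : Monotone (f ∘ π) := Tuple.monotone_sort (f ∘ e)
  have hle {k l : N} (h : π.symm k ≤ π.symm l) : f k ≤ f l := by simpa using hmono h
  refine ⟨π, ?_⟩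
  ext k
  rw [Finset.mem_filter_univ]
  constructor
  · intro h
    have hki : k ≠ i := by rintro rfl; exact lt_irrefl _ h
    have hf := hle h.le
    by_contra hk
    simp [f, hk, hki, hi] at hf
  · intro hk
    by_contra h
    have hf := hle (not_lt.mp h)
    simp [f, hk, hi] at hf

/-- Exchanging `i` and `j` in an ordering exchanges them in the predecessors of `i`. -/
lemma filter_lt_trans_swap {N : Type*} [Fintype N] [DecidableEq N]
    (π : Fin (Fintype.card N) ≃ N) (i j : N) :
    (Finset.univ.filter fun k =>
        (π.trans (Equiv.swap i j)).symm k < (π.trans (Equiv.swap i j)).symm j) =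
      (Finset.univ.filter fun k => π.symm k < π.symm i).image (Equiv.swap i j) := by
  ext k
  simp only [Finset.mem_filter_univ, Finset.mem_image, Equiv.symm_trans_apply,
    Equiv.symm_swap, Equiv.swap_apply_right]
  exact ⟨fun h => ⟨_, h, Equiv.swap_apply_self i j k⟩,
    by rintro ⟨l, h, rfl⟩; rwa [Equiv.swap_apply_self]⟩

lemma image_swap_of_notMem {N : Type*} [DecidableEq N] {i j : N} {P : Finset N}
    (hi : i ∉ P) (hj : j ∉ P) : P.image (Equiv.swap i j) = P := by
  exact (Finset.image_congr fun k hk => Equiv.swap_apply_of_ne_of_ne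
    (ne_of_mem_of_not_mem hk hi) (ne_of_mem_of_not_mem hk hj)).trans Finset.image_id

/-- If `i` is at least as desirable as `j`, then the marginal contribution of `j` does not exceed
that of `i` once their positions are exchanged. -/
lemma marginal_image_swap_le {N : Type*} [DecidableEq N] (v : Finset N → ℝ) {i j : N}
    (h : ∀ B : Finset N, i ∉ B → j ∉ B → v (insert i B) ≥ v (insert j B))
    {P : Finset N} (hi : i ∉ P) :
    v (insert j (P.image (Equiv.swap i j))) - v (P.image (Equiv.swap i j)) ≤
      v (insert i P) - v P := by
  by_cases hj : j ∈ P
  · obtain ⟨B, hjB, rfl⟩ : ∃ B, j ∉ B ∧ insert j B = P :=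
      ⟨P.erase j, Finset.notMem_erase j P, Finset.insert_erase hj⟩
    have hiB : i ∉ B := fun hB => hi (Finset.mem_insert_of_mem hB)
    rw [Finset.image_insert, Equiv.swap_apply_right, image_swap_of_notMem hiB hjB,
      Finset.insert_comm j i]
    linarith [h B hiB hjB]
  · rw [image_swap_of_notMem hi hj]
    linarith [h P hi hj]

/-- The Shapley value is strictly increasing in desirability. -/
lemma shapley_lt_of_desirable {N : Type*} [Fintype N] [DecidableEq N] (v : Finset N → ℝ)
    {i j : N}
    (hex : ∃ C : Finset N, i ∉ C ∧ j ∉ C ∧ v (insert i C) > v (insert j C))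
    (h : ∀ B : Finset N, i ∉ B → j ∉ B → v (insert i B) ≥ v (insert j B)) :
    shapley v j < shapley v i := by
  unfold shapley
  refine mul_lt_mul_of_pos_left ?_ (by positivity)
  rw [← Equiv.sum_comp (Equiv.equivCongr (Equiv.refl _) (Equiv.swap i j))
    (fun π : Fin (Fintype.card N) ≃ N =>
      v (insert j (Finset.univ.filter fun k => π.symm k < π.symm j)) -
        v (Finset.univ.filter fun k => π.symm k < π.symm j))]
  have hcongr (π : Fin (Fintype.card N) ≃ N) :
      Equiv.equivCongr (Equiv.refl _) (Equiv.swap i j) π = π.trans (Equiv.swap i j) := rfl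
  simp only [hcongr, filter_lt_trans_swap]
  refine Finset.sum_lt_sum (fun π _ => marginal_image_swap_le v h (by simp)) ?_
  obtain ⟨C, hi, hj, hC⟩ := hex
  obtain ⟨π, hπ⟩ := exists_ordering_filter_lt_eq i C hi
  refine ⟨π, Finset.mem_univ π, ?_⟩
  rw [hπ, image_swap_of_notMem hi hj]
  linarith

lemma shapley_nonneg {N : Type*} [Fintype N] [DecidableEq N] {v : Finset N → ℝ}
    (hmono : MonotoneCF v) (i : N) : 0 ≤ shapley v i :=
  mul_nonneg (by positivity) <| Finset.sum_nonneg fun _ _ =>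
    sub_nonneg.mpr <| hmono _ _ <| Finset.subset_insert _ _

/-- If `v_c` is non-negative and monotone, `φ* > 0`, `ρ ∈ (0,1]`, `v* > 0`, and
`v_c({i}) ≤ (φ_i/φ*)^ρ v*` for every `i`, then `r_i = (φ_i/φ*)^ρ v*` for every `i`, and
for any distinct `i, j` such that `v_c(C ∪ {i}) > v_c(C ∪ {j})` for some `C ⊆ N \ {i,j}`
and `v_c(B ∪ {i}) ≥ v_c(B ∪ {j})` for every `B ⊆ N \ {i,j}`, one has `r_i > r_j`. -/
theorem rectified_rewards_strict_desirability {N : Type*} [Fintype N] [DecidableEq N]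
    [Nonempty N] (v : Finset N → ℝ) (hnn : NonnegCF v) (hmono : MonotoneCF v)
    (hphi : 0 < phiStar v)
    (ρ : ℝ) (hρ : ρ ∈ Set.Ioc (0 : ℝ) 1) (vstar : ℝ) (hvstar : 0 < vstar)
    (hv : ∀ i, v {i} ≤ (shapley v i / phiStar v) ^ ρ * vstar) :
    (∀ i, reward v ρ vstar i = (shapley v i / phiStar v) ^ ρ * vstar) ∧
    (∀ i j : N, i ≠ j →
      (∃ C : Finset N, i ∉ C ∧ j ∉ C ∧ v (insert i C) > v (insert j C)) →
      (∀ B : Finset N, i ∉ B → j ∉ B → v (insert i B) ≥ v (insert j B)) →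
      reward v ρ vstar i > reward v ρ vstar j) := by
  have hr (i : N) : reward v ρ vstar i = (shapley v i / phiStar v) ^ ρ * vstar :=
    max_eq_right (hv i)
  refine ⟨hr, fun i j _ hex h => ?_⟩
  rw [hr, hr]
  have hlt := shapley_lt_of_desirable v hex h
  have hnonneg := div_nonneg (shapley_nonneg hmono j) hphi.le
  exact mul_lt_mul_of_pos_right
    (Real.rpow_lt_rpow hnonneg (div_lt_div_of_pos_right hlt hphi) hρ.1) hvstar
end

section
/- There exist a set N of 4 parties, a non-negative monotone characteristic function v_c : 2^N → ℝ, and distinct parties i, j ∈ N such that: (i) there exists C ⊆ N \ {i,j} with v_c(C ∪ {i}) > v_c(C ∪ {j}); (ii) v_c(B ∪ {i}) ≥ v_c(B ∪ {j}) for every B ⊆ N \ {i,j}; and yet, taking ρ = 1 and v* = v_c(N), the rectified ρ-Shapley fair rewards satisfy r_i = r_j. Hence the rectified rewards with v* = v_c(N) may violate strict desirability (F3) and thus fairness (R5). -/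
open Finset

/-- A four-party game in which party `2` is dominant, party `3` is null, and party `0` contributes
more than party `1` exactly to the coalitions containing `2`. -/
def dominantGame (C : Finset (Fin 4)) : ℤ :=
  if 2 ∈ C then 20 + (if 0 ∈ C then 2 else if 1 ∈ C then 1 else 0)
  else if 0 ∈ C ∨ 1 ∈ C then 2 else 0

lemma shapley_intCast {N : Type*} [Fintype N] [DecidableEq N] (u : Finset N → ℤ) (i : N) :
    shapley (fun C => (u C : ℝ)) i = ((Nat.factorial (Fintype.card N) : ℝ))⁻¹ *
      ((∑ π : Fin (Fintype.card N) ≃ N,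
        (u (insert i (Finset.univ.filter fun j => π.symm j < π.symm i)) -
          u (Finset.univ.filter fun j => π.symm j < π.symm i)) : ℤ) : ℝ) := by
  simp only [shapley, Int.cast_sum, Int.cast_sub]

lemma sum_marginal_dominantGame (i : Fin 4) :
    ∑ π : Fin (Fintype.card (Fin 4)) ≃ Fin 4,
      (dominantGame (insert i (Finset.univ.filter fun j => π.symm j < π.symm i)) -
        dominantGame (Finset.univ.filter fun j => π.symm j < π.symm i)) =
      ![32, 20, 476, 0] i := by
  revert i
  decide +kernel

lemma shapley_dominantGame (i : Fin 4) :
    shapley (fun C => (dominantGame C : ℝ)) i = ((![32, 20, 476, 0] i : ℤ) : ℝ) / 24 := by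
  rw [shapley_intCast, sum_marginal_dominantGame, Fintype.card_fin, inv_mul_eq_div]
  norm_num [Nat.factorial]

lemma le_phiStar {N : Type*} [Fintype N] [DecidableEq N] [Nonempty N]
    (v : Finset N → ℝ) (i : N) : shapley v i ≤ phiStar v :=
  Finset.le_sup' (shapley v) (Finset.mem_univ i)

lemma reward_one_eq_singleton {N : Type*} [Fintype N] [DecidableEq N] [Nonempty N]
    {v : Finset N → ℝ} {vstar : ℝ} {i : N} (hpos : 0 < phiStar v)
    (h : shapley v i * vstar ≤ v {i} * phiStar v) : reward v 1 vstar i = v {i} := by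
  rw [reward, Real.rpow_one, div_mul_eq_mul_div]
  exact max_eq_left ((div_le_iff₀ hpos).2 h)

/-- There exist a set of 4 parties, a non-negative monotone characteristic function `v_c`,
and distinct parties `i ≠ j` such that `i` is strictly more desirable than `j`
(there is `C ⊆ N \ {i,j}` with `v_c(C ∪ {i}) > v_c(C ∪ {j})` and
`v_c(B ∪ {i}) ≥ v_c(B ∪ {j})` for every `B ⊆ N \ {i,j}`), yet with `ρ = 1` and
`v* = v_c(N)` the rectified ρ-Shapley fair rewards satisfy `r_i = r_j`; hence strict
desirability (F3), and thus fairness (R5), may be violated. -/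
theorem rectified_rewards_may_violate_F3 :
    ∃ v : Finset (Fin 4) → ℝ, NonnegCF v ∧ MonotoneCF v ∧
      ∃ i j : Fin 4, i ≠ j ∧
        (∃ C : Finset (Fin 4), i ∉ C ∧ j ∉ C ∧ v (insert i C) > v (insert j C)) ∧
        (∀ B : Finset (Fin 4), i ∉ B → j ∉ B → v (insert i B) ≥ v (insert j B)) ∧
        reward v 1 (v Finset.univ) i = reward v 1 (v Finset.univ) j := by
  have hstar : (476 : ℝ) / 24 ≤ phiStar fun C => (dominantGame C : ℝ) := by
    have h := le_phiStar (fun C => (dominantGame C : ℝ)) 2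
    rw [shapley_dominantGame] at h
    simpa using h
  have hpos : 0 < phiStar fun C => (dominantGame C : ℝ) := lt_of_lt_of_le (by norm_num) hstar
  have huniv : dominantGame Finset.univ = 22 := by decide +kernel
  have h₀ : dominantGame {0} = 2 := by decide +kernel
  have h₁ : dominantGame {1} = 2 := by decide +kernel
  have hnonneg : ∀ C, 0 ≤ dominantGame C := by decide +kernel
  have hmono : ∀ C C', C ⊆ C' → dominantGame C ≤ dominantGame C' := by decide +kernel
  have hdesirable : ∀ B, (0 : Fin 4) ∉ B → (1 : Fin 4) ∉ B →
      dominantGame (insert 1 B) ≤ dominantGame (insert 0 B) := by decide +kernel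
  have hstrict : dominantGame (insert 1 {2}) < dominantGame (insert 0 {2}) := by decide +kernel
  refine ⟨fun C => (dominantGame C : ℝ), fun C => Int.cast_nonneg (hnonneg C),
    fun C C' h => Int.cast_le.2 (hmono C C' h), 0, 1, by decide,
    ⟨{2}, by decide, by decide, Int.cast_lt.2 hstrict⟩,
    fun B hi hj => Int.cast_le.2 (hdesirable B hi hj), ?_⟩
  rw [reward_one_eq_singleton hpos, reward_one_eq_singleton hpos]
  · simp only [h₀, h₁]
  · rw [shapley_dominantGame]
    simp only [h₁, huniv]
    norm_num
    linarith
  · rw [shapley_dominantGame]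
    simp only [h₀, huniv]
    norm_num
    linarith
end
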